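/- In the Setting, for every λ with 0 < λ < 1 one has limsup_{m→∞} F_m(λ) ≤ lim_{m→∞} F_m(0) + #𝓕 · log(C·b)/(−log λ). (This is the combinatorial form of the spectral density estimate: the limiting spectral density function exceeds its value at zero by at most a constant times 1/(−log λ).) -/

import Mathlib

open scoped ComplexOrder

open Filter

/-- The standard basis vector `δ_σ` of `ℓ²(I)`. -/
noncomputable def delta {I : Type*} [DecidableEq I] (σ : I) : lp (fun _ : I => ℂ) 2 :=
  lp.single 2 σ 1

open Polynomial in
theorem aux_prod {n : Type*} [Fintype n] [DecidableEq n] (A : Matrix n n ℂ) (hA : A.IsHermitian)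
    (hint : ∀ i j, ∃ z : ℤ, A i j = (z : ℂ)) :
    1 ≤ ∏ i ∈ Finset.univ.filter (fun i => hA.eigenvalues i ≠ 0), |hA.eigenvalues i| := by
  choose B hB using hint
  have hAB : A = (Matrix.of B).map (Int.castRingHom ℂ) := by
    ext i j; simp [hB]
  have h1 : (Matrix.of B).charpoly.map (Int.castRingHom ℂ) =
      ∏ i, (X - C (hA.eigenvalues i : ℂ)) := by
    rw [← Matrix.charpoly_map, ← hAB]; exact hA.charpoly_eq
  set k := (Finset.univ.filter (fun i => ¬ hA.eigenvalues i ≠ 0)).card with hk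
  have h2 : ∏ i, (X - C (hA.eigenvalues i : ℂ)) =
      (∏ i ∈ Finset.univ.filter (fun i => hA.eigenvalues i ≠ 0),
        (X - C (hA.eigenvalues i : ℂ))) * X ^ k := by
    rw [← Finset.prod_filter_mul_prod_filter_not Finset.univ (fun i => hA.eigenvalues i ≠ 0)]
    congr 1
    rw [hk, ← Finset.prod_const]
    refine Finset.prod_congr rfl fun i hi => ?_
    have : hA.eigenvalues i = 0 := by simpa using hi
    simp [this]
  have h3 : (((Matrix.of B).charpoly.coeff k : ℤ) : ℂ) =
      ∏ i ∈ Finset.univ.filter (fun i => hA.eigenvalues i ≠ 0), (-(hA.eigenvalues i : ℂ)) := by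
    have := congrArg (fun p => p.coeff k) (h1.trans h2)
    simp only [coeff_map, eq_intCast] at this
    rw [this]
    have h0 := coeff_mul_X_pow (∏ i ∈ Finset.univ.filter (fun i => hA.eigenvalues i ≠ 0),
        (X - C (hA.eigenvalues i : ℂ))) k 0
    rw [zero_add] at h0
    rw [h0, coeff_zero_eq_eval_zero, eval_prod]
    simp
  have h4 := congrArg norm h3
  rw [norm_prod, Complex.norm_intCast] at h4
  simp only [norm_neg, Complex.norm_real, Real.norm_eq_abs] at h4
  rw [← h4]
  have hne : (Matrix.of B).charpoly.coeff k ≠ 0 := by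
    intro h
    rw [h] at h4
    have : (0:ℝ) < ∏ i ∈ Finset.univ.filter (fun i => hA.eigenvalues i ≠ 0),
        |hA.eigenvalues i| := Finset.prod_pos fun i hi => abs_pos.2 (by simpa using hi)
    rw [← h4] at this
    simp at this
  exact_mod_cast Int.one_le_abs hne

theorem aux_bound {n : Type*} [Fintype n] [DecidableEq n] (A : Matrix n n ℂ) (hA : A.IsHermitian)
    (K : ℝ) (hK : ∀ i, ∑ j, ‖A i j‖ ≤ K) (i : n) : hA.eigenvalues i ≤ K := by
  have hev : Module.End.HasEigenvalue (Matrix.toLin' A) (hA.eigenvalues i : ℂ) := by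
    apply Module.End.hasEigenvalue_of_hasEigenvector (x := ⇑(hA.eigenvectorBasis i))
    rw [Module.End.hasEigenvector_iff, Module.End.mem_eigenspace_iff]
    refine ⟨?_, ?_⟩
    · rw [Matrix.toLin'_apply, hA.mulVec_eigenvectorBasis]
      ext j; simp
    · intro h
      exact hA.eigenvectorBasis.orthonormal.ne_zero i (by ext j; exact congrFun h j)
  obtain ⟨k, hk⟩ := eigenvalue_mem_ball hev
  rw [mem_closedBall_iff_norm] at hk
  have h1 : ‖(hA.eigenvalues i : ℂ)‖ ≤ ‖A k k‖ + ‖(hA.eigenvalues i : ℂ) - A k k‖ := by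
    simpa using norm_add_le (A k k) ((hA.eigenvalues i : ℂ) - A k k)
  have h2 := Finset.add_sum_erase Finset.univ (fun j => ‖A k j‖) (Finset.mem_univ k)
  have h3 := hK k
  have h4 : hA.eigenvalues i ≤ ‖(hA.eigenvalues i : ℂ)‖ := by
    rw [Complex.norm_real]; exact le_abs_self _
  linarith

theorem aux_count {n : Type*} [Fintype n] [DecidableEq n] (A : Matrix n n ℂ) (hA : A.PosSemidef)
    (hint : ∀ i j, ∃ z : ℤ, A i j = (z : ℂ))
    (K : ℝ) (hK1 : 1 ≤ K) (hK : ∀ i, ∑ j, ‖A i j‖ ≤ K) (lam : ℝ) (h0 : 0 < lam) (h1 : lam < 1) :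
    ((Finset.univ.filter fun i : n => hA.1.eigenvalues i ≤ lam).card : ℝ) ≤
      ((Finset.univ.filter fun i : n => hA.1.eigenvalues i ≤ 0).card : ℝ) +
        Fintype.card n * Real.log K / (-Real.log lam) := by
  have hll : 0 < -Real.log lam := neg_pos.2 (Real.log_neg h0 h1)
  have hlK : 0 ≤ Real.log K := Real.log_nonneg hK1
  have hprod := aux_prod A hA.1 hint
  have hlog : 0 ≤ ∑ i, Real.log (hA.1.eigenvalues i) := by
    have h := Real.log_nonneg hprod
    rw [Real.log_prod (fun i hi => abs_ne_zero.2 (by simpa using hi))] at h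
    simp only [Real.log_abs] at h
    rw [Finset.sum_filter_of_ne] at h
    · exact h
    · intro i _ hi hz
      rw [hz] at hi; simp at hi
  have hle : ∀ i, Real.log (hA.1.eigenvalues i) ≤
      Real.log K + ((if hA.1.eigenvalues i ≤ lam then 1 else 0) -
        (if hA.1.eigenvalues i ≤ 0 then 1 else 0)) * Real.log lam := by
    intro i
    have hn := hA.eigenvalues_nonneg i
    rcases hn.eq_or_lt with hz | hp
    · rw [← hz]; simp [h0.le, hlK]
    · rw [if_neg (not_le.2 hp)]
      split_ifs with hl
      · have := Real.log_le_log hp hl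
        linarith
      · have := Real.log_le_log hp (aux_bound A hA.1 K hK i)
        linarith
  have hs := hlog.trans (Finset.sum_le_sum fun i _ => hle i)
  rw [Finset.sum_add_distrib, ← Finset.sum_mul, Finset.sum_sub_distrib, Finset.sum_boole,
    Finset.sum_boole, Finset.sum_const, nsmul_eq_mul, Finset.card_univ] at hs
  rw [← sub_le_iff_le_add', le_div_iff₀ hll]
  linarith

/-- **Spectral density estimate (combinatorial form).** In the amenable Setting, for every
`0 < λ < 1`, `limsup_m F_m(λ) ≤ lim_m F_m(0) + #𝓕 · log(C·b)/(−log λ)`. -/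
theorem spectral_density_estimate
    {I : Type*} [MetricSpace I] [Countable I] [DecidableEq I]
    {G : Type*} [Group G] [Countable G] [MulAction G I]
    (hfree : ∀ (g : G) (σ : I), g • σ = σ → g = 1)
    (hiso : ∀ (g : G) (σ τ : I), dist (g • σ) (g • τ) = dist σ τ)
    (𝓕 : Finset I)
    (hfund : ∀ σ : I, ∃! τ : I, τ ∈ 𝓕 ∧ ∃ g : G, g • σ = τ)
    (C : ℝ) (b : ℕ) (hC : 0 < C) (hCb : 1 ≤ C * b)
    (hballfin : ∀ σ : I, {τ : I | dist σ τ ≤ 1}.Finite)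
    (hballcard : ∀ σ : I, {τ : I | dist σ τ ≤ 1}.ncard ≤ b)
    (Δ : lp (fun _ : I => ℂ) 2 →L[ℂ] lp (fun _ : I => ℂ) 2)
    (hΔpos : Δ.IsPositive)
    (hΔequiv : ∀ (g : G) (σ τ : I),
      (Δ (delta (g • σ)) : ∀ _ : I, ℂ) (g • τ) = (Δ (delta σ) : ∀ _ : I, ℂ) τ)
    (hΔint : ∀ σ τ : I, ∃ z : ℤ, (Δ (delta σ) : ∀ _ : I, ℂ) τ = (z : ℂ) ∧ |(z : ℝ)| ≤ C)
    (hΔloc : ∀ σ τ : I, 1 < dist σ τ → (Δ (delta σ) : ∀ _ : I, ℂ) τ = 0)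
    (Λ : ℕ → Finset G) (hΛ : ∀ m, (Λ m).Nonempty)
    (Y : ℕ → Finset I)
    (hY : ∀ m, Y m = (Λ m).biUnion fun g => 𝓕.image fun σ => g • σ)
    (hreg : ∀ k : ℕ, Filter.Tendsto
      (fun m => (({σ : I | σ ∈ Y m ∧ ∃ τ : I, τ ∉ Y m ∧ dist σ τ ≤ (k : ℝ)}.ncard : ℝ)
        / (Λ m).card)) Filter.atTop (nhds 0))
    (Δm : (m : ℕ) → Matrix (Y m) (Y m) ℂ)
    (hΔm : ∀ m, (Δm m).PosSemidef)
    (hΔmint : ∀ m, ∀ σ τ : Y m, ∃ z : ℤ, Δm m σ τ = (z : ℂ) ∧ |(z : ℝ)| ≤ C)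
    (hΔmloc : ∀ m, ∀ σ τ : Y m, 1 < dist (σ : I) (τ : I) → Δm m σ τ = 0)
    (hΔmagree : ∀ m, ∀ σ τ : Y m,
      ((∀ ρ : I, ρ ∉ Y m → 1 < dist (σ : I) ρ) ∨ (∀ ρ : I, ρ ∉ Y m → 1 < dist (τ : I) ρ)) →
      Δm m σ τ = (Δ (delta (σ : I)) : ∀ _ : I, ℂ) (τ : I))
    (F : ℕ → ℝ → ℝ)
    (hF : ∀ (m : ℕ) (lam : ℝ), F m lam =
      ((Finset.univ.filter fun i : Y m => (hΔm m).1.eigenvalues i ≤ lam).card : ℝ)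
        / (Λ m).card)
    (L : ℝ) (hL : Filter.Tendsto (fun m => F m 0) Filter.atTop (nhds L))
    (lam : ℝ) (hlam0 : 0 < lam) (hlam1 : lam < 1) :
    Filter.limsup (fun m => F m lam) Filter.atTop ≤
      L + 𝓕.card * Real.log (C * b) / (-Real.log lam) := by
  have hll : 0 < -Real.log lam := neg_pos.2 (Real.log_neg hlam0 hlam1)
  have hlK : 0 ≤ Real.log (C * b) := Real.log_nonneg hCb
  have hpos : ∀ m, (0:ℝ) < (Λ m).card := fun m => by exact_mod_cast (hΛ m).card_pos
  have key : ∀ m, F m lam ≤ F m 0 + 𝓕.card * Real.log (C * b) / (-Real.log lam) := by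
    intro m
    have hrow : ∀ i, ∑ j, ‖Δm m i j‖ ≤ C * b := by
      intro i
      have hc : (Finset.univ.filter fun j : Y m => dist (i : I) (j : I) ≤ 1).card ≤ b := by
        refine le_trans ?_ (hballcard i)
        rw [← Finset.card_map (Function.Embedding.subtype _), ← Set.ncard_coe_finset]
        refine Set.ncard_le_ncard ?_ (hballfin i)
        intro x hx
        simp only [Finset.coe_map, Set.mem_image, Finset.mem_coe, Finset.mem_filter] at hx
        obtain ⟨y, hy, rfl⟩ := hx
        exact hy.2
      have hle : ∀ j, ‖Δm m i j‖ ≤ (if dist (i : I) (j : I) ≤ 1 then 1 else 0) * C := by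
        intro j
        split_ifs with h
        · obtain ⟨z, hz, hzC⟩ := hΔmint m i j
          rw [hz, Complex.norm_intCast, one_mul]; exact hzC
        · rw [hΔmloc m i j (not_le.1 h)]; simp
      refine (Finset.sum_le_sum fun j _ => hle j).trans ?_
      rw [← Finset.sum_mul, Finset.sum_boole, mul_comm]
      exact mul_le_mul_of_nonneg_left (by exact_mod_cast hc) hC.le
    have h := aux_count (Δm m) (hΔm m) (fun i j => (hΔmint m i j).imp fun _ h => h.1)
      (C * b) hCb hrow lam hlam0 hlam1
    have hcard : (Fintype.card (Y m) : ℝ) ≤ (Λ m).card * 𝓕.card := by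
      rw [Fintype.card_coe, hY m]
      have : ((Λ m).biUnion fun g => 𝓕.image fun σ => g • σ).card ≤ (Λ m).card * 𝓕.card :=
        Finset.card_biUnion_le_card_mul _ _ _ fun g _ => Finset.card_image_le
      exact_mod_cast this
    rw [hF, hF, div_add' _ _ _ (hpos m).ne']
    refine div_le_div_of_nonneg_right (h.trans ?_) (hpos m).le
    have h2 : Fintype.card (Y m) * Real.log (C * b) / (-Real.log lam) ≤
        ((Λ m).card * 𝓕.card) * Real.log (C * b) / (-Real.log lam) := by gcongr
    have h3 : ((Λ m).card * 𝓕.card) * Real.log (C * b) / (-Real.log lam) =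
      𝓕.card * Real.log (C * b) / (-Real.log lam) * (Λ m).card := by ring
    linarith
  have hT : Filter.Tendsto (fun m => F m 0 + 𝓕.card * Real.log (C * b) / (-Real.log lam))
      Filter.atTop (nhds (L + 𝓕.card * Real.log (C * b) / (-Real.log lam))) :=
    hL.add_const _
  rw [← hT.limsup_eq]
  refine Filter.limsup_le_limsup (Filter.Eventually.of_forall key) ?_ hT.isBoundedUnder_le
  refine Filter.IsBoundedUnder.isCoboundedUnder_le ⟨0, ?_⟩
  refine Filter.eventually_map.2 (Filter.Eventually.of_forall fun m => ?_)
  show 0 ≤ F m lam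
  rw [hF]
  positivity
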